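/- Define f : (0,∞) → ℝ by f(λ) = 2λ·e^{−2λ} + e^{−λ}·√(3e^{−λ} + 1)·Σ_{k=2}^{∞} λᵏ√k / k!. Then f(λ) < 1 for every λ ∈ (0, 4/3]. -/

import Mathlib

/-- The series `∑_{k=2}^∞ λᵏ √k / k!`. -/
noncomputable def erSeries (l : ℝ) : ℝ :=
  ∑' k : ℕ, l ^ (k + 2) * Real.sqrt ((k : ℝ) + 2) / (Nat.factorial (k + 2) : ℝ)

/-- The asymptotic bound `f(λ) = 2λe^{-2λ} + e^{-λ}√(3e^{-λ}+1) ∑_{k=2}^∞ λᵏ√k/k!`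
for the energy per vertex of a sparse Erdős–Rényi graph. -/
noncomputable def erBound (l : ℝ) : ℝ :=
  2 * l * Real.exp (-2 * l) +
    Real.exp (-l) * Real.sqrt (3 * Real.exp (-l) + 1) * erSeries l

/-- A polynomial majorant of `erSeries` on `[0, 4/3]`. -/
noncomputable def erSeriesPoly (l : ℝ) : ℝ :=
  14143 / 10000 * l ^ 2 / 2 + 17321 / 10000 * l ^ 3 / 6
    + 2 * l ^ 4 / 24
    + 22361 / 10000 * l ^ 5 / 120 + 24495 / 10000 * l ^ 6 / 720
    + 26458 / 10000 * l ^ 7 / 5040 + 28285 / 10000 * l ^ 8 / 40320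
    + l ^ 9 / 40320 * (27 / 23)

/-- The degree-seven Taylor polynomial of `exp` at `0`. -/
noncomputable def expTaylorSeven (l : ℝ) : ℝ :=
  1 + l + l ^ 2 / 2 + l ^ 3 / 6 + l ^ 4 / 24 + l ^ 5 / 120 + l ^ 6 / 720 + l ^ 7 / 5040

/-- Beyond `k = 9`, the terms of `erSeries` are dominated by a geometric series. -/
theorem erSeries_term_le {l : ℝ} (hl : 0 ≤ l) (j : ℕ) :
    l ^ (j + 9) * √((j : ℝ) + 9) / ((j + 9).factorial : ℝ) ≤ l ^ 9 / 40320 * (l / 9) ^ j := by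
  have hsqrt : √((j : ℝ) + 9) ≤ (j : ℝ) + 9 := by
    rw [Real.sqrt_le_left (by positivity)]
    have : (0 : ℝ) ≤ j := j.cast_nonneg
    nlinarith
  have hfac : (40320 : ℝ) * 9 ^ j ≤ ((j + 8).factorial : ℝ) := by
    have h := Nat.factorial_mul_pow_le_factorial (m := 8) (n := j)
    rw [add_comm 8 j] at h
    exact_mod_cast h
  have hsucc : ((j + 9).factorial : ℝ) = ((j : ℝ) + 9) * ((j + 8).factorial : ℝ) := by
    rw [Nat.factorial_succ (j + 8)]
    push_cast
    ring
  calc l ^ (j + 9) * √((j : ℝ) + 9) / ((j + 9).factorial : ℝ)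
      ≤ l ^ (j + 9) * ((j : ℝ) + 9) / ((j + 9).factorial : ℝ) := by gcongr
    _ = l ^ (j + 9) / ((j + 8).factorial : ℝ) := by
        rw [hsucc]
        field_simp
    _ ≤ l ^ (j + 9) / (40320 * 9 ^ j) := by gcongr
    _ = l ^ 9 / 40320 * (l / 9) ^ j := by
        rw [div_pow, pow_add]
        field_simp

/-- A polynomial upper bound for `erSeries` on `[0, 4/3]`. -/
theorem erSeries_le {l : ℝ} (hl : 0 ≤ l) (hl' : l ≤ 4 / 3) :
    erSeries l ≤ erSeriesPoly l := by
  have hgeom : HasSum (fun j : ℕ => l ^ 9 / 40320 * (l / 9) ^ j)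
      (l ^ 9 / 40320 * (1 - l / 9)⁻¹) :=
    (hasSum_geometric_of_lt_one (by positivity) (by linarith)).mul_left _
  set a : ℕ → ℝ := fun k => l ^ (k + 2) * √((k : ℝ) + 2) / ((k + 2).factorial : ℝ) with ha
  have hle : ∀ j, a (j + 7) ≤ l ^ 9 / 40320 * (l / 9) ^ j := by
    intro j
    have h := erSeries_term_le hl j
    have hcast : ((j + 7 : ℕ) : ℝ) + 2 = (j : ℝ) + 9 := by
      push_cast
      ring
    simpa only [ha, hcast] using h
  have hsum : Summable fun j => a (j + 7) :=
    hgeom.summable.of_nonneg_of_le (fun j => by positivity) hle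
  have htail : ∑' j, a (j + 7) ≤ l ^ 9 / 40320 * (27 / 23) := by
    calc ∑' j, a (j + 7) ≤ l ^ 9 / 40320 * (1 - l / 9)⁻¹ :=
          hasSum_le hle hsum.hasSum hgeom
      _ ≤ l ^ 9 / 40320 * (27 / 23) := by
          gcongr
          rw [inv_le_comm₀ (by linarith) (by norm_num)]
          linarith
  have hsplit : erSeries l = ∑ k ∈ Finset.range 7, a k + ∑' j, a (j + 7) :=
    (((summable_nat_add_iff 7).1 hsum).sum_add_tsum_nat_add 7).symm
  have hterm : ∀ (k : ℕ) (r : ℝ), 0 ≤ r → (k : ℝ) + 2 ≤ r ^ 2 →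
      a k ≤ r * l ^ (k + 2) / ((k + 2).factorial : ℝ) := by
    intro k r hr h
    have := (Real.sqrt_le_left hr).2 h
    rw [mul_comm r]
    simp only [ha]
    gcongr
  have h2 := hterm 0 (14143 / 10000) (by norm_num) (by norm_num)
  have h3 := hterm 1 (17321 / 10000) (by norm_num) (by norm_num)
  have h4 := hterm 2 2 (by norm_num) (by norm_num)
  have h5 := hterm 3 (22361 / 10000) (by norm_num) (by norm_num)
  have h6 := hterm 4 (24495 / 10000) (by norm_num) (by norm_num)
  have h7 := hterm 5 (26458 / 10000) (by norm_num) (by norm_num)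
  have h8 := hterm 6 (28285 / 10000) (by norm_num) (by norm_num)
  norm_num [Nat.factorial] at h2 h3 h4 h5 h6 h7 h8
  rw [hsplit, erSeriesPoly]
  simp only [Finset.sum_range_succ, Finset.sum_range_zero]
  linarith

/-- The degree-seven Taylor polynomial of `exp` is a lower bound on `[0, ∞)`. -/
theorem taylor_seven_le_exp {l : ℝ} (hl : 0 ≤ l) :
    expTaylorSeven l ≤ Real.exp l := by
  have h := Real.sum_le_exp_of_nonneg hl 8
  norm_num [Finset.sum_range_succ, Nat.factorial] at h
  rw [expTaylorSeven]
  linarith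

/-- The tangent line of `√` at `1.34 ^ 2` bounds `√(3x + 1)` from above. -/
theorem sqrt_three_mul_add_one_le {x : ℝ} (hx : 0 ≤ x) :
    √(3 * x + 1) ≤ (3 * x + 1 + (67 / 50) ^ 2) / (67 / 25) := by
  have h := Real.sq_sqrt (show 0 ≤ 3 * x + 1 by positivity)
  rw [le_div_iff₀ (by norm_num)]
  nlinarith [sq_nonneg (√(3 * x + 1) - 67 / 50)]

/-- The polynomial inequality behind `erBound_lt_one`; it holds because the Bernstein coefficients
of the difference of the two sides on `[0, 4/3]` are positive. -/
theorem erBound_polynomial_lt {l : ℝ} (hl : 0 ≤ l) (hl' : l ≤ 4 / 3) :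
    2 * l + (3 + (1 + (67 / 50) ^ 2) * expTaylorSeven l) / (67 / 25) *
      erSeriesPoly l <
      expTaylorSeven l ^ 2 := by
  have hb : ∀ i j : ℕ, 0 ≤ l ^ i * (4 - 3 * l) ^ j := fun i j =>
    mul_nonneg (pow_nonneg hl i) (pow_nonneg (by linarith) j)
  rw [erSeriesPoly, expTaylorSeven]
  linarith [hb 0 16, hb 1 15, hb 2 14, hb 3 13, hb 4 12, hb 5 11, hb 6 10,
    hb 7 9, hb 8 8, hb 9 7, hb 10 6, hb 11 5, hb 12 4,
    hb 13 3, hb 14 2, hb 15 1, hb 16 0]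

/-- `f(λ) < 1` for all `λ ∈ (0, 4/3]`. -/
theorem erBound_lt_one : ∀ l ∈ Set.Ioc (0 : ℝ) (4 / 3), erBound l < 1 := by
  rintro l ⟨hl, hl'⟩
  have hS := erSeries_le hl.le hl'
  have hT := taylor_seven_le_exp hl.le
  have hQ := erBound_polynomial_lt hl.le hl'
  have hS0 : 0 ≤ erSeries l := tsum_nonneg fun k => by positivity
  have hP0 : 0 ≤ erSeriesPoly l := by
    rw [erSeriesPoly]
    positivity
  have hT0 : 0 < expTaylorSeven l := by
    rw [expTaylorSeven]
    positivity
  have hx : Real.exp (-l) ≤ (expTaylorSeven l)⁻¹ := by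
    rw [Real.exp_neg]
    gcongr
  have hsq : Real.exp (-2 * l) = Real.exp (-l) ^ 2 := by
    rw [← Real.exp_nat_mul]
    congr 1
    push_cast
    ring
  have hx0 := (Real.exp_pos (-l)).le
  rw [erBound, hsq]
  calc 2 * l * Real.exp (-l) ^ 2 + Real.exp (-l) * √(3 * Real.exp (-l) + 1) * erSeries l
      ≤ 2 * l * Real.exp (-l) ^ 2 +
          Real.exp (-l) * ((3 * Real.exp (-l) + 1 + (67 / 50) ^ 2) / (67 / 25)) * erSeriesPoly l := by
        gcongr
        exact sqrt_three_mul_add_one_le hx0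
    _ ≤ 2 * l * (expTaylorSeven l)⁻¹ ^ 2 +
          (expTaylorSeven l)⁻¹ * ((3 * (expTaylorSeven l)⁻¹ + 1 + (67 / 50) ^ 2) / (67 / 25)) *
            erSeriesPoly l := by
        gcongr
    _ = (2 * l + (3 + (1 + (67 / 50) ^ 2) * expTaylorSeven l) / (67 / 25) * erSeriesPoly l) /
          expTaylorSeven l ^ 2 := by
        field_simp
        ring
    _ < 1 := by rwa [div_lt_one (by positivity)]
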